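/- Equivariant fibrancy of Funᵘ(G̃, A): let G be a group with strict actions on *-categories A, C and D. Let c : C ⥤ D be an equivariant *-functor that is injective on objects and a unitary equivalence, and let Φ : C ♯ G̃ ⥤ A be an equivariant *-functor, where C ♯ G̃ carries the diagonal strict G-action. Then there exists an equivariant *-functor Ψ : D ♯ G̃ ⥤ A (for the diagonal action on D ♯ G̃) such that (c × 𝟭 G̃) ⋙ Ψ = Φ (equality of functors). -/

import Mathlib

open CategoryTheory

universe v u

/-- A `*`-category: a category with an involution fixing objects. -/
class StarCategoryStruct (C : Type u) [Category.{v} C] : Type (max u v) where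
  star : ∀ {X Y : C}, (X ⟶ Y) → (Y ⟶ X)
  star_star : ∀ {X Y : C} (f : X ⟶ Y), star (star f) = f
  star_id : ∀ X : C, star (𝟙 X) = 𝟙 X
  star_comp : ∀ {X Y Z : C} (f : X ⟶ Y) (g : Y ⟶ Z), star (f ≫ g) = star g ≫ star f

/-- A morphism is unitary if its star is a two-sided inverse. -/
def IsUnitary {C : Type*} [Category C] [StarCategoryStruct C] {X Y : C} (u : X ⟶ Y) : Prop :=
  u ≫ StarCategoryStruct.star u = 𝟙 X ∧ StarCategoryStruct.star u ≫ u = 𝟙 Y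

/-- A functor between `*`-categories is a `*`-functor if it preserves the involution. -/
def IsStarFunctor {C D : Type*} [Category C] [Category D]
    [StarCategoryStruct C] [StarCategoryStruct D] (F : C ⥤ D) : Prop :=
  ∀ {X Y : C} (f : X ⟶ Y),
    F.map (StarCategoryStruct.star f) = StarCategoryStruct.star (F.map f)

/-- A `*`-functor is a unitary equivalence if it admits a `*`-functor inverse up to unitary
natural isomorphisms. -/
def IsUnitaryEquivalence {C D : Type*} [Category C] [Category D]
    [StarCategoryStruct C] [StarCategoryStruct D] (F : C ⥤ D) : Prop :=
  ∃ G : D ⥤ C, IsStarFunctor G ∧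
    ∃ (η : F ⋙ G ≅ 𝟭 C) (ε : G ⋙ F ≅ 𝟭 D),
      (∀ X : C, IsUnitary (η.hom.app X)) ∧ (∀ Y : D, IsUnitary (ε.hom.app Y))

/-- A `*`-functor is good (a unitary isofibration) if unitary morphisms out of an image object
lift along it. -/
def IsGood {C D : Type*} [Category C] [Category D]
    [StarCategoryStruct C] [StarCategoryStruct D] (F : C ⥤ D) : Prop :=
  ∀ (c : C) (d : D) (u : F.obj c ⟶ d), IsUnitary u →
    ∃ (c' : C) (h : F.obj c' = d) (v : c ⟶ c'),
      IsUnitary v ∧ F.map v ≫ eqToHom h = u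

theorem groupoid_inv_id {G : Type*} [Groupoid G] (x : G) :
    Groupoid.inv (𝟙 x) = 𝟙 x := by
  simp [Groupoid.inv_eq_inv]

theorem groupoid_inv_comp' {G : Type*} [Groupoid G] {x y z : G} (f : x ⟶ y) (g : y ⟶ z) :
    Groupoid.inv (f ≫ g) = Groupoid.inv g ≫ Groupoid.inv f := by
  simp [Groupoid.inv_eq_inv]

theorem groupoid_inv_inv {G : Type*} [Groupoid G] {x y : G} (f : x ⟶ y) :
    Groupoid.inv (Groupoid.inv f) = f := by
  simp [Groupoid.inv_eq_inv]

/-- For a `*`-category `C` and a groupoid `G`, the product `C ♯ G` is a `*`-category with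
involution `(f, φ)* = (f*, φ⁻¹)`. -/
instance prodStarCategoryStruct (C : Type*) [Category C] [StarCategoryStruct C]
    (G : Type*) [Groupoid G] : StarCategoryStruct (C × G) where
  star f := (StarCategoryStruct.star f.1, Groupoid.inv f.2)
  star_star f := Prod.ext (StarCategoryStruct.star_star f.1) (groupoid_inv_inv f.2)
  star_id X := Prod.ext (StarCategoryStruct.star_id X.1) (groupoid_inv_id X.2)
  star_comp f g :=
    Prod.ext (StarCategoryStruct.star_comp f.1 g.1) (groupoid_inv_comp' f.2 g.2)

/-- The chaotic (indiscrete) groupoid on a type: exactly one morphism between any two objects. -/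
def Chaotic (G : Type u) : Type u := G

/-- Reinterpret an element as an object of the chaotic groupoid. -/
def Chaotic.mk {G : Type u} (g : G) : Chaotic G := g

/-- Reinterpret an object of the chaotic groupoid as an element. -/
def Chaotic.el {G : Type u} (g : Chaotic G) : G := g

instance {G : Type u} : Groupoid (Chaotic G) where
  Hom _ _ := PUnit
  id _ := PUnit.unit
  comp _ _ := PUnit.unit
  inv _ := PUnit.unit
  id_comp _ := rfl
  comp_id _ := rfl
  assoc _ _ _ := rfl
  inv_comp _ := rfl
  comp_inv _ := rfl

/-- The left-translation functor on the chaotic groupoid of a group. -/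
def leftTrans {G : Type u} [Group G] (g : G) : Chaotic G ⥤ Chaotic G where
  obj x := Chaotic.mk (g * x.el)
  map _ := PUnit.unit
  map_id _ := rfl
  map_comp _ _ := rfl

open StarCategoryStruct

theorem IsUnitary.id {C : Type*} [Category C] [StarCategoryStruct C] (X : C) :
    IsUnitary (𝟙 X) := by
  simp [IsUnitary, star_id]

theorem IsUnitary.comp {C : Type*} [Category C] [StarCategoryStruct C] {X Y Z : C}
    {f : X ⟶ Y} {g : Y ⟶ Z} (hf : IsUnitary f) (hg : IsUnitary g) : IsUnitary (f ≫ g) := by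
  refine ⟨?_, ?_⟩
  · rw [star_comp, Category.assoc, ← Category.assoc g, hg.1, Category.id_comp, hf.1]
  · rw [star_comp, Category.assoc, ← Category.assoc (star f), hf.2, Category.id_comp, hg.2]

theorem IsUnitary.eqToHom {C : Type*} [Category C] [StarCategoryStruct C] {X Y : C}
    (h : X = Y) : IsUnitary (eqToHom h) := by
  subst h
  exact IsUnitary.id X

theorem IsUnitary.map {C D : Type*} [Category C] [Category D] [StarCategoryStruct C]
    [StarCategoryStruct D] {F : C ⥤ D} (hF : IsStarFunctor F) {X Y : C} {f : X ⟶ Y}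
    (hf : IsUnitary f) : IsUnitary (F.map f) := by
  refine ⟨?_, ?_⟩
  · rw [← hF, ← F.map_comp, hf.1, F.map_id]
  · rw [← hF, ← F.map_comp, hf.2, F.map_id]

theorem heq_conj_star {C : Type*} [Category C] [StarCategoryStruct C] {X X' Y Y' Z Z' W W' : C}
    {e : X ⟶ Y} {e' : X' ⟶ Y'} {f : Y ⟶ Z} {f' : Y' ⟶ Z'} {k : W ⟶ Z} {k' : W' ⟶ Z'}
    (hX : X = X') (hY : Y = Y') (hZ : Z = Z') (hW : W = W')
    (he : e ≍ e') (hf : f ≍ f') (hk : k ≍ k') :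
    (e ≫ f ≫ star k) ≍ (e' ≫ f' ≫ star k') := by
  subst hX hY hZ hW
  cases he
  cases hf
  cases hk
  rfl

theorem IsUnitaryEquivalence.isEquivalence {C D : Type*} [Category C] [Category D]
    [StarCategoryStruct C] [StarCategoryStruct D] {F : C ⥤ D} (hF : IsUnitaryEquivalence F) :
    F.IsEquivalence := by
  obtain ⟨H, -, η, ε, -, -⟩ := hF
  exact (CategoryTheory.Equivalence.mk F H η.symm ε).isEquivalence_functor

/-- A faithful functor that is injective on objects is a monomorphism of categories. -/
theorem functor_eq_of_comp_eq {X C D : Type*} [Category X] [Category C] [Category D]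
    {c : C ⥤ D} [c.Faithful] (hc : Function.Injective c.obj) {F F' : X ⥤ C}
    (h : F ⋙ c = F' ⋙ c) : F = F' := by
  have hobj : ∀ x, F.obj x = F'.obj x := fun x => hc (Functor.congr_obj h x)
  refine CategoryTheory.Functor.ext hobj fun x y f => c.map_injective ?_
  simpa [eqToHom_map] using Functor.congr_hom h f

/-- Every object of the target of a unitary equivalence injective on objects is unitarily
isomorphic to an object of the image, by the identity if it already lies in the image. -/
theorem IsUnitaryEquivalence.exists_unitary {C D : Type*} [Category C] [Category D]
    [StarCategoryStruct C] [StarCategoryStruct D] {c : C ⥤ D} (hc : IsUnitaryEquivalence c)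
    (hcinj : Function.Injective c.obj) (d : D) :
    ∃ (x : C) (e : c.obj x ⟶ d), IsUnitary e ∧
      ∀ y : C, d = c.obj y → x = y ∧ e ≍ 𝟙 (c.obj y) := by
  by_cases h : ∃ y, c.obj y = d
  · obtain ⟨y, rfl⟩ := h
    refine ⟨y, 𝟙 _, IsUnitary.id _, fun z hz => ?_⟩
    obtain rfl := hcinj hz
    exact ⟨rfl, HEq.rfl⟩
  · obtain ⟨H, -, -, ε, -, hε⟩ := hc
    exact ⟨H.obj d, ε.hom.app d, hε d, fun y hy => (h ⟨y, hy.symm⟩).elim⟩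

/-- A choice of objects `R x` of `C` with unitaries from `c.obj (R x)` to `P.obj x` lifts a
`*`-functor `P` to `C` by conjugation. -/
noncomputable def conjLift {X C D : Type*} [Category X] [Category C] [Category D]
    [StarCategoryStruct D] (c : C ⥤ D) [c.Full] [c.Faithful] (P : X ⥤ D) (R : X → C)
    (E : ∀ x, c.obj (R x) ⟶ P.obj x) (hE : ∀ x, IsUnitary (E x)) : X ⥤ C where
  obj := R
  map {x y} f := c.preimage (E x ≫ P.map f ≫ star (E y))
  map_id x := c.map_injective (by simpa using (hE x).1)
  map_comp {x y z} f g := c.map_injective (by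
    have h : star (E y) ≫ E y ≫ P.map g ≫ star (E z) = P.map g ≫ star (E z) := by
      rw [← Category.assoc, (hE y).2, Category.id_comp]
    simp [h])

theorem map_conjLift_map {X C D : Type*} [Category X] [Category C] [Category D]
    [StarCategoryStruct D] (c : C ⥤ D) [c.Full] [c.Faithful] (P : X ⥤ D) (R : X → C)
    (E : ∀ x, c.obj (R x) ⟶ P.obj x) (hE : ∀ x, IsUnitary (E x)) {x y : X} (f : x ⟶ y) :
    c.map ((conjLift c P R E hE).map f) = E x ≫ P.map f ≫ star (E y) :=
  c.map_preimage _

theorem isStarFunctor_conjLift {X C D : Type*} [Category X] [Category C] [Category D]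
    [StarCategoryStruct X] [StarCategoryStruct C] [StarCategoryStruct D]
    (c : C ⥤ D) [c.Full] [c.Faithful] (hc : IsStarFunctor c) (P : X ⥤ D) (hP : IsStarFunctor P)
    (R : X → C) (E : ∀ x, c.obj (R x) ⟶ P.obj x) (hE : ∀ x, IsUnitary (E x)) :
    IsStarFunctor (conjLift c P R E hE) := fun f => c.map_injective (by
  have h : E _ ≫ P.map (star f) ≫ star (E _) = star (E _ ≫ P.map f ≫ star (E _)) := by
    rw [hP, star_comp, star_comp, StarCategoryStruct.star_star, Category.assoc]
  rw [hc, map_conjLift_map, map_conjLift_map]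
  exact h)

/-- A trivial cofibration of `*`-categories with strict `G`-action admits an equivariant
retraction after taking the product with the chaotic groupoid of `G`. -/
theorem exists_equivariant_retraction {G : Type u} [Group G]
    {C D : Type*} [Category C] [Category D] [StarCategoryStruct C] [StarCategoryStruct D]
    (ρC : G → (C ⥤ C)) (hC1 : ρC 1 = 𝟭 C)
    (hCmul : ∀ g h : G, ρC g ⋙ ρC h = ρC (h * g))
    (ρD : G → (D ⥤ D)) (hD1 : ρD 1 = 𝟭 D)
    (hDmul : ∀ g h : G, ρD g ⋙ ρD h = ρD (h * g))
    (hDstar : ∀ g : G, IsStarFunctor (ρD g))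
    (c : C ⥤ D) (hcstar : IsStarFunctor c)
    (hcinj : Function.Injective c.obj) (hcequiv : IsUnitaryEquivalence c)
    (hcequivariant : ∀ g : G, ρC g ⋙ c = c ⋙ ρD g) :
    ∃ R : (D × Chaotic G) ⥤ C, IsStarFunctor R ∧
      (∀ g : G, (ρD g).prod (leftTrans g) ⋙ R = R ⋙ ρC g) ∧
      c.prod (𝟭 (Chaotic G)) ⋙ R = CategoryTheory.Prod.fst C (Chaotic G) := by
  have := hcequiv.isEquivalence
  choose r e he her using hcequiv.exists_unitary hcinj
  have hCD : ∀ g x, c.obj ((ρC g).obj x) = (ρD g).obj (c.obj x) := fun g x =>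
    Functor.congr_obj (hcequivariant g) x
  have hDo : ∀ g h d, (ρD h).obj ((ρD g).obj d) = (ρD (h * g)).obj d := fun g h d =>
    Functor.congr_obj (hDmul g h) d
  have hCo : ∀ g h x, (ρC h).obj ((ρC g).obj x) = (ρC (h * g)).obj x := fun g h x =>
    Functor.congr_obj (hCmul g h) x
  have hDinv : ∀ g d, (ρD g).obj ((ρD g⁻¹).obj d) = d := fun g d => by
    rw [hDo, mul_inv_cancel, hD1, Functor.id_obj]
  have hCinv : ∀ g x, (ρC g).obj ((ρC g⁻¹).obj x) = x := fun g x => by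
    rw [hCo, mul_inv_cancel, hC1, Functor.id_obj]
  have e_congr : ∀ {d d' : D}, d = d' → e d ≍ e d' := by
    rintro d _ rfl
    rfl
  have map_congr : ∀ (g : G) {X X' Y Y' : D} {f : X ⟶ Y} {f' : X' ⟶ Y'}, X = X' → Y = Y' →
      f ≍ f' → (ρD g).map f ≍ (ρD g).map f' := by
    rintro g X _ Y _ f _ rfl rfl ⟨⟩
    rfl
  obtain ⟨R, hRdef, E, hE, E_heq⟩ : ∃ R : D × Chaotic G → C,
      (∀ p, R p = (ρC p.2.el).obj (r ((ρD p.2.el⁻¹).obj p.1))) ∧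
      ∃ E : ∀ p, c.obj (R p) ⟶ p.1, (∀ p, IsUnitary (E p)) ∧
        ∀ p, E p ≍ (ρD p.2.el).map (e ((ρD p.2.el⁻¹).obj p.1)) :=
    ⟨_, fun _ => rfl, fun p => eqToHom (hCD _ _) ≫
        (ρD p.2.el).map (e ((ρD p.2.el⁻¹).obj p.1)) ≫ eqToHom (hDinv _ _),
      fun p => (IsUnitary.eqToHom _).comp (((he _).map (hDstar _)).comp (IsUnitary.eqToHom _)),
      fun p => (eqToHom_comp_heq _ _).trans (comp_eqToHom_heq _ _)⟩
  refine ⟨conjLift c (CategoryTheory.Prod.fst D (Chaotic G)) R E hE,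
    isStarFunctor_conjLift c hcstar (CategoryTheory.Prod.fst D (Chaotic G)) (fun _ => rfl) R E hE,
    fun g => ?_, ?_⟩
  · have hcancel : ∀ p : D × Chaotic G, (ρD (g * p.2.el)⁻¹).obj ((ρD g).obj p.1) =
        (ρD p.2.el⁻¹).obj p.1 := fun p => by
      rw [hDo]
      congr 2
      group
    have hR : ∀ p : D × Chaotic G,
        R ((ρD g).obj p.1, Chaotic.mk (g * p.2.el)) = (ρC g).obj (R p) := fun p => by
      rw [hRdef, hRdef, hCo]
      exact congrArg (fun d => (ρC (g * p.2.el)).obj (r d)) (hcancel p)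
    have hcR : ∀ p : D × Chaotic G, c.obj (R ((ρD g).obj p.1, Chaotic.mk (g * p.2.el))) =
        (ρD g).obj (c.obj (R p)) := fun p => by rw [hR, hCD]
    have hEg : ∀ p : D × Chaotic G,
        E ((ρD g).obj p.1, Chaotic.mk (g * p.2.el)) ≍ (ρD g).map (E p) := fun p => by
      refine (E_heq _).trans (HEq.trans ?_
        (map_congr g (by rw [hRdef, hCD]) (hDinv p.2.el p.1) (E_heq p).symm))
      refine HEq.trans (map_congr (g * p.2.el) ?_ (hcancel p) (e_congr (hcancel p))) ?_
      · exact congrArg (fun d => c.obj (r d)) (hcancel p)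
      · exact (Functor.hcongr_hom (hDmul p.2.el g) _).symm
    refine functor_eq_of_comp_eq hcinj ?_
    refine Functor.hext (fun p => congrArg c.obj (hR p)) fun p q f => ?_
    have hrhs : c.map ((ρC g).map
          ((conjLift c (CategoryTheory.Prod.fst D (Chaotic G)) R E hE).map f)) ≍
        (ρD g).map (c.map ((conjLift c (CategoryTheory.Prod.fst D (Chaotic G)) R E hE).map f)) :=
      Functor.hcongr_hom (hcequivariant g) _
    refine HEq.trans ?_ hrhs.symm
    have hmap : (ρD g).map (E p ≫ f.1 ≫ star (E q)) =
        (ρD g).map (E p) ≫ (ρD g).map f.1 ≫ star ((ρD g).map (E q)) := by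
      rw [Functor.map_comp, Functor.map_comp, hDstar]
    refine HEq.trans ?_ (heq_of_eq
      ((congrArg (ρD g).map
        (map_conjLift_map c (CategoryTheory.Prod.fst D (Chaotic G)) R E hE f)).trans hmap)).symm
    refine (heq_of_eq
      (map_conjLift_map c (CategoryTheory.Prod.fst D (Chaotic G)) R E hE _)).trans ?_
    exact heq_conj_star (hcR p) rfl rfl (hcR q) (hEg p) HEq.rfl (hEg q)
  · have hcinv : ∀ p : C × Chaotic G,
        (ρD p.2.el⁻¹).obj (c.obj p.1) = c.obj ((ρC p.2.el⁻¹).obj p.1) := fun p => (hCD _ _).symm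
    have hR : ∀ p : C × Chaotic G, R (c.obj p.1, p.2) = p.1 := fun p => by
      rw [hRdef, (her _ _ (hcinv p)).1, hCinv]
    have hEc : ∀ p : C × Chaotic G, E (c.obj p.1, p.2) ≍ 𝟙 (c.obj p.1) :=
      fun p => by
        refine (E_heq _).trans ?_
        refine (map_congr p.2.el (congrArg c.obj (her _ _ (hcinv p)).1) (hcinv p)
          (her _ _ (hcinv p)).2).trans ?_
        rw [CategoryTheory.Functor.map_id, ← hCD, hCinv]
    refine functor_eq_of_comp_eq hcinj ?_
    refine Functor.hext (fun p => congrArg c.obj (hR p)) fun p q f => ?_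
    refine (heq_of_eq
      (map_conjLift_map c (CategoryTheory.Prod.fst D (Chaotic G)) R E hE _)).trans ?_
    refine (heq_conj_star (congrArg c.obj (hR p)) rfl rfl (congrArg c.obj (hR q)) (hEc p)
      (HEq.refl (c.map f.1)) (hEc q)).trans (heq_of_eq ?_)
    rw [star_id, Category.comp_id, Category.id_comp]
    rfl

/-- Equivariant fibrancy of `Funᵘ(G̃, A)`, expressed via the exponential law: every equivariant
`*`-functor `C ♯ G̃ ⥤ A` extends along a trivial cofibration `c : C ⥤ D` to an equivariant
`*`-functor `D ♯ G̃ ⥤ A`. -/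
theorem equivariant_extension_along_trivialCofibration
    {G : Type u} [Group G]
    {A C D : Type*} [Category A] [Category C] [Category D]
    [StarCategoryStruct A] [StarCategoryStruct C] [StarCategoryStruct D]
    (ρA : G → (A ⥤ A)) (hA1 : ρA 1 = 𝟭 A)
    (hAmul : ∀ g h : G, ρA g ⋙ ρA h = ρA (h * g))
    (hAstar : ∀ g : G, IsStarFunctor (ρA g))
    (ρC : G → (C ⥤ C)) (hC1 : ρC 1 = 𝟭 C)
    (hCmul : ∀ g h : G, ρC g ⋙ ρC h = ρC (h * g))
    (hCstar : ∀ g : G, IsStarFunctor (ρC g))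
    (ρD : G → (D ⥤ D)) (hD1 : ρD 1 = 𝟭 D)
    (hDmul : ∀ g h : G, ρD g ⋙ ρD h = ρD (h * g))
    (hDstar : ∀ g : G, IsStarFunctor (ρD g))
    (c : C ⥤ D) (hcstar : IsStarFunctor c)
    (hcinj : Function.Injective c.obj) (hcequiv : IsUnitaryEquivalence c)
    (hcequivariant : ∀ g : G, ρC g ⋙ c = c ⋙ ρD g)
    (Φ : (C × Chaotic G) ⥤ A) (hΦstar : IsStarFunctor Φ)
    (hΦequivariant : ∀ g : G, (ρC g).prod (leftTrans g) ⋙ Φ = Φ ⋙ ρA g) :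
    ∃ Ψ : (D × Chaotic G) ⥤ A, IsStarFunctor Ψ ∧
      (∀ g : G, (ρD g).prod (leftTrans g) ⋙ Ψ = Ψ ⋙ ρA g) ∧
      c.prod (𝟭 (Chaotic G)) ⋙ Ψ = Φ := by
  obtain ⟨R, hRstar, hRequivariant, hRc⟩ := exists_equivariant_retraction ρC hC1 hCmul ρD hD1 hDmul
    hDstar c hcstar hcinj hcequiv hcequivariant
  refine ⟨R.prod' (CategoryTheory.Prod.snd D (Chaotic G)) ⋙ Φ, fun f => ?_, fun g => ?_, ?_⟩
  · refine Eq.trans ?_ (hΦstar ((R.prod' (CategoryTheory.Prod.snd D (Chaotic G))).map f))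
    exact congrArg Φ.map (Prod.ext (hRstar f) rfl)
  · calc (ρD g).prod (leftTrans g) ⋙ R.prod' (CategoryTheory.Prod.snd D (Chaotic G)) ⋙ Φ
        = ((ρD g).prod (leftTrans g) ⋙ R).prod' (CategoryTheory.Prod.snd D (Chaotic G) ⋙ leftTrans g) ⋙ Φ := rfl
      _ = R.prod' (CategoryTheory.Prod.snd D (Chaotic G)) ⋙ (ρC g).prod (leftTrans g) ⋙ Φ := by
          rw [hRequivariant]
          rfl
      _ = (R.prod' (CategoryTheory.Prod.snd D (Chaotic G)) ⋙ Φ) ⋙ ρA g := by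
          rw [hΦequivariant]
          rfl
  · calc c.prod (𝟭 (Chaotic G)) ⋙ R.prod' (CategoryTheory.Prod.snd D (Chaotic G)) ⋙ Φ
        = (c.prod (𝟭 (Chaotic G)) ⋙ R).prod' (CategoryTheory.Prod.snd C (Chaotic G)) ⋙ Φ := rfl
      _ = Φ := by
          rw [hRc]
          rfl
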